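/- arXiv:2305.07391 — 3 statements merged into one kernel-verified Lean document; each statement's English description precedes it below -/
import Mathlib

section
/- Let V be a real inner product space of dimension 2m with orthonormal basis (e_i), let I₁, I₂, I₃ be orthogonal complex structures with I₁I₂ = I₃ = −I₂I₁, and let F be any skew-adjoint endomorphism of V. Then for all x, y ∈ V: (1/4)·Σ_i Ω(e_i, F e_i, x, y) = Σₐ ⟨F̂, ωₐ⟩·ωₐ(x,y) + ⟨(I₁FI₁ + I₂FI₂ + I₃FI₃)(x), y⟩. -/
open scoped RealInnerProductSpace

/-- The wedge product of two `2`-forms, as a `4`-form (given by the explicit 6-term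
formula). -/
def wedge2 {V : Type*} (α β : V → V → ℝ) : V → V → V → V → ℝ :=
  fun x y z w =>
    α x y * β z w - α x z * β y w + α x w * β y z +
      α y z * β x w - α y w * β x z + α z w * β x y

/-- The Kraines `4`-form `Ω = Σₐ ωₐ ∧ ωₐ` of a quaternionic triple. -/
noncomputable def kraines {V : Type*} [NormedAddCommGroup V] [InnerProductSpace ℝ V]
    (I : Fin 3 → V →ₗ[ℝ] V) : V → V → V → V → ℝ :=
  fun x y z w =>
    ∑ a : Fin 3, wedge2 (fun p q => ⟪I a p, q⟫) (fun p q => ⟪I a p, q⟫) x y z w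

/-- A linear isometry squaring to `-id` is skew-adjoint. -/
theorem inner_map_left_eq_neg_of_complexStructure
    {V : Type*} [NormedAddCommGroup V] [InnerProductSpace ℝ V] {J : V →ₗ[ℝ] V}
    (hJ2 : ∀ x, J (J x) = -x) (hJ : ∀ x y, ⟪J x, J y⟫ = ⟪x, y⟫) (x y : V) :
    ⟪J x, y⟫ = -⟪x, J y⟫ := by
  rw [← hJ (J x) y, hJ2, inner_neg_left]

/-- Contraction of `ω ∧ ω` with a skew-adjoint `F`, where `ω` is the `2`-form of a
skew-adjoint `J`. -/
theorem sum_wedge2_self_contraction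
    {V ι : Type*} [NormedAddCommGroup V] [InnerProductSpace ℝ V] [Fintype ι]
    (e : OrthonormalBasis ι ℝ V) {J F : V →ₗ[ℝ] V}
    (hJ : ∀ x y, ⟪J x, y⟫ = -⟪x, J y⟫) (hF : ∀ x y, ⟪F x, y⟫ = -⟪x, F y⟫) (x y : V) :
    ∑ i, wedge2 (fun p q => ⟪J p, q⟫) (fun p q => ⟪J p, q⟫) (e i) (F (e i)) x y =
      2 * (∑ i, ∑ j, ⟪F (e i), e j⟫ * ⟪J (e i), e j⟫) * ⟪J x, y⟫ + 4 * ⟪J (F (J x)), y⟫ := by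
  have trace_eq : ∀ i, ∑ j, ⟪F (e i), e j⟫ * ⟪J (e i), e j⟫ = ⟪J (e i), F (e i)⟫ := by
    intro i
    rw [← e.sum_inner_mul_inner (J (e i)) (F (e i))]
    exact Finset.sum_congr rfl fun j _ => by rw [real_inner_comm (e j) (F (e i)), mul_comm]
  have contract : ∀ z w, ∑ i, ⟪J (e i), z⟫ * ⟪J (F (e i)), w⟫ = -⟪J z, F (J w)⟫ := by
    intro z w
    rw [← e.sum_inner_mul_inner (J z) (F (J w)), ← Finset.sum_neg_distrib]
    refine Finset.sum_congr rfl fun i _ => ?_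
    rw [hJ (e i) z, hJ (F (e i)) w, hF (e i) (J w), real_inner_comm (J z) (e i)]
    ring
  have hxy : ⟪J x, F (J y)⟫ = ⟪J (F (J x)), y⟫ := by
    rw [hJ (F (J x)) y, hF (J x) (J y), neg_neg]
  have hyx : ⟪J y, F (J x)⟫ = -⟪J (F (J x)), y⟫ := by
    rw [hJ (F (J x)) y, neg_neg, real_inner_comm]
  calc
    _ = ∑ i, (2 * ⟪J (e i), F (e i)⟫ * ⟪J x, y⟫ - 2 * (⟪J (e i), x⟫ * ⟪J (F (e i)), y⟫) +
          2 * (⟪J (e i), y⟫ * ⟪J (F (e i)), x⟫)) :=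
      Finset.sum_congr rfl fun i _ => by simp only [wedge2]; ring
    _ = _ := by
      rw [Finset.sum_add_distrib, Finset.sum_sub_distrib, ← Finset.sum_mul, ← Finset.mul_sum,
        ← Finset.mul_sum, ← Finset.mul_sum, contract, contract, hxy, hyx,
        Finset.sum_congr rfl fun i _ => trace_eq i]
      ring

/-- The identity `½ L*_F Ω = Σₐ ⟨F̂, ωₐ⟩ ωₐ + Σₐ Iₐ F Iₐ` from the proof of Lemma 5.4,
stated pointwise for an arbitrary skew-adjoint endomorphism `F`. -/
theorem contraction_kraines_with_F
    {V : Type*} [NormedAddCommGroup V] [InnerProductSpace ℝ V] [FiniteDimensional ℝ V]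
    {m : ℕ} (e : OrthonormalBasis (Fin (2 * m)) ℝ V)
    (I : Fin 3 → V →ₗ[ℝ] V)
    (hI2 : ∀ a, ∀ x : V, I a (I a x) = -x)
    (hIorth : ∀ a, ∀ x y : V, ⟪I a x, I a y⟫ = ⟪x, y⟫)
    (h12 : ∀ x : V, I 0 (I 1 x) = I 2 x)
    (h21 : ∀ x : V, I 1 (I 0 x) = -(I 2 x))
    (F : V →ₗ[ℝ] V) (hFskew : ∀ x y : V, ⟪F x, y⟫ = -⟪x, F y⟫) :
    ∀ x y : V,
      (1 / 4 : ℝ) * ∑ i, kraines I (e i) (F (e i)) x y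
        = (∑ a : Fin 3,
            ((1 / 2 : ℝ) * ∑ i, ∑ j, ⟪F (e i), e j⟫ * ⟪I a (e i), e j⟫) * ⟪I a x, y⟫) +
          ∑ a : Fin 3, ⟪I a (F (I a x)), y⟫ := by
  intro x y
  simp only [kraines]
  rw [Finset.sum_comm, Finset.mul_sum, ← Finset.sum_add_distrib]
  refine Finset.sum_congr rfl fun a _ => ?_
  rw [sum_wedge2_self_contraction e
    (inner_map_left_eq_neg_of_complexStructure (hI2 a) (hIorth a)) hFskew x y]
  ring
end

section
/- Let V be a real inner product space of dimension 2m with orthonormal basis (e_k), let I₁, I₂, I₃ be orthogonal complex structures with I₁I₂ = I₃ = −I₂I₁, and let Ω be the Kraines 4-form. Let h be a symmetric (self-adjoint) traceless endomorphism of V. Then for every v ∈ V: ⟨ι_h(v⌟Ω), v⌟Ω⟩ = −4·⟨((m+4)·C(h) + 3·h)(v), v⟩, where C(h) = I₁hI₁ + I₂hI₂ + I₃hI₃. -/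
open scoped RealInnerProductSpace

section HelperLemmas

variable {V : Type*} [NormedAddCommGroup V] [InnerProductSpace ℝ V]
  {ι : Type*} [Fintype ι]

/-- The `3`-form `p ∧ ω`, where `ω x y = ⟪A x, y⟫` and `p` is viewed as a `1`-form. -/
noncomputable def wedgeOneTwo (p : V) (A : V →ₗ[ℝ] V) (x y z : V) : ℝ :=
  ⟪p, x⟫ * ⟪A y, z⟫ - ⟪p, y⟫ * ⟪A x, z⟫ + ⟪p, z⟫ * ⟪A x, y⟫

theorem wedgeOneTwo_swap {A : V →ₗ[ℝ] V} (hA : ∀ x y, ⟪A x, y⟫ = -⟪x, A y⟫) (p x y z : V) :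
    wedgeOneTwo p A y x z = -wedgeOneTwo p A x y z := by
  have hyx : ⟪A y, x⟫ = -⟪A x, y⟫ := by rw [hA, real_inner_comm]
  simp only [wedgeOneTwo, hyx]
  ring

theorem wedgeOneTwo_rotate {A : V →ₗ[ℝ] V} (hA : ∀ x y, ⟪A x, y⟫ = -⟪x, A y⟫) (p x y z : V) :
    wedgeOneTwo p A z x y = wedgeOneTwo p A x y z := by
  have hzy : ⟪A z, y⟫ = -⟪A y, z⟫ := by rw [hA, real_inner_comm]
  have hzx : ⟪A z, x⟫ = -⟪A x, z⟫ := by rw [hA, real_inner_comm]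
  simp only [wedgeOneTwo, hzy, hzx]
  ring

theorem kraines_eq_sum_wedgeOneTwo (I : Fin 3 → V →ₗ[ℝ] V) (v x y z : V) :
    kraines I v x y z = 2 * ∑ a, wedgeOneTwo (I a v) (I a) x y z := by
  simp only [kraines, wedge2, wedgeOneTwo, Finset.mul_sum]
  exact Finset.sum_congr rfl fun a _ => by ring

theorem OrthonormalBasis.sum_inner_mul_inner_right (e : OrthonormalBasis ι ℝ V) (x y : V) :
    ∑ i, ⟪x, e i⟫ * ⟪y, e i⟫ = ⟪x, y⟫ := by
  rw [← e.sum_inner_mul_inner x y]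
  exact Finset.sum_congr rfl fun i _ => by rw [real_inner_comm (e i) y]

/-- Contraction of `(p ∧ A)(h ·, ·, ·)` with `q ∧ B` over an orthonormal basis. -/
theorem sum_wedgeOneTwo_mul_wedgeOneTwo (e : OrthonormalBasis ι ℝ V) {A B h : V →ₗ[ℝ] V}
    (hA : ∀ x y, ⟪A x, y⟫ = -⟪x, A y⟫) (hB : ∀ x y, ⟪B x, y⟫ = -⟪x, B y⟫)
    (hh : ∀ x y, ⟪h x, y⟫ = ⟪x, h y⟫) (p q : V) :
    ∑ i, ∑ j, ∑ k, wedgeOneTwo p A (h (e i)) (e j) (e k) * wedgeOneTwo q B (e i) (e j) (e k) =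
      ⟪h p, q⟫ * (∑ j, ⟪A (e j), B (e j)⟫) + 2 * (⟪p, q⟫ * ∑ i, ⟪A (h (e i)), B (e i)⟫)
        + 2 * ⟪h p, B (A q)⟫ + 2 * ⟪h q, A (B p)⟫ - 2 * ⟪B p, h (A q)⟫ := by
  have sum_k (x y : V) : ∑ k, wedgeOneTwo p A (h x) y (e k) * wedgeOneTwo q B x y (e k) =
      ⟪h p, x⟫ * ⟪q, x⟫ * ⟪A y, B y⟫ + ⟪p, y⟫ * ⟪q, y⟫ * ⟪A (h x), B x⟫
        + ⟪A (h x), y⟫ * ⟪B x, y⟫ * ⟪p, q⟫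
        + ⟪h p, x⟫ * (⟪q, y⟫ * ⟪A (B x), y⟫) - ⟪h p, x⟫ * (⟪B x, y⟫ * ⟪A q, y⟫)
        + ⟪q, x⟫ * (⟪p, y⟫ * ⟪B (A (h x)), y⟫) - ⟪q, x⟫ * (⟪A (h x), y⟫ * ⟪B p, y⟫)
        + ⟪h (A q), x⟫ * (⟪p, y⟫ * ⟪B x, y⟫)
        + ⟪B p, x⟫ * (⟪A (h x), y⟫ * ⟪q, y⟫) := by
    have hl (z : V) : wedgeOneTwo p A (h x) y z =
        ⟪⟪p, h x⟫ • A y - ⟪p, y⟫ • A (h x) + ⟪A (h x), y⟫ • p, z⟫ := by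
      simp only [wedgeOneTwo, inner_add_left, inner_sub_left, real_inner_smul_left]; ring
    have hr (z : V) : wedgeOneTwo q B x y z =
        ⟪⟪q, x⟫ • B y - ⟪q, y⟫ • B x + ⟪B x, y⟫ • q, z⟫ := by
      simp only [wedgeOneTwo, inner_add_left, inner_sub_left, real_inner_smul_left]; ring
    simp only [hl, hr, e.sum_inner_mul_inner_right]
    have hAy_Bx : ⟪A y, B x⟫ = -⟪A (B x), y⟫ := by rw [hA, real_inner_comm]
    have hAy_q : ⟪A y, q⟫ = -⟪A q, y⟫ := by rw [hA, real_inner_comm]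
    have hAhx_By : ⟪A (h x), B y⟫ = -⟪B (A (h x)), y⟫ := by rw [hB, neg_neg]
    have hp_By : ⟪p, B y⟫ = -⟪B p, y⟫ := by rw [hB, neg_neg]
    have hAhx_q : ⟪A (h x), q⟫ = -⟪h (A q), x⟫ := by rw [hA, hh, real_inner_comm]
    have hp_Bx : ⟪p, B x⟫ = -⟪B p, x⟫ := by rw [hB, neg_neg]
    have hp_hx : ⟪p, h x⟫ = ⟪h p, x⟫ := (hh p x).symm
    simp only [inner_add_left, inner_sub_left, inner_add_right, inner_sub_right,
      real_inner_smul_left, real_inner_smul_right, hAy_Bx, hAy_q, hAhx_By, hp_By, hAhx_q, hp_Bx, hp_hx]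
    ring
  have sum_j (x : V) :
      ∑ j, ∑ k, wedgeOneTwo p A (h x) (e j) (e k) * wedgeOneTwo q B x (e j) (e k) =
      ⟪h p, x⟫ * ⟪q, x⟫ * (∑ j, ⟪A (e j), B (e j)⟫) + 2 * (⟪p, q⟫ * ⟪A (h x), B x⟫)
        + 2 * (⟪h p, x⟫ * ⟪B (A q), x⟫) + 2 * (⟪h (A (B p)), x⟫ * ⟪q, x⟫)
        - 2 * (⟪B p, x⟫ * ⟪h (A q), x⟫) := by
    have hq_ABx : ⟪q, A (B x)⟫ = ⟪B (A q), x⟫ := by rw [hB, hA, neg_neg]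
    have hBx_Aq : ⟪B x, A q⟫ = -⟪B (A q), x⟫ := by rw [hB, real_inner_comm]
    have hp_BAhx : ⟪p, B (A (h x))⟫ = ⟪h (A (B p)), x⟫ := by
      rw [hh, hA, hB, neg_neg]
    have hAhx_Bp : ⟪A (h x), B p⟫ = -⟪h (A (B p)), x⟫ := by
      rw [hA, hh, real_inner_comm]
    have hp_Bx : ⟪p, B x⟫ = -⟪B p, x⟫ := by rw [hB, neg_neg]
    have hAhx_q : ⟪A (h x), q⟫ = -⟪h (A q), x⟫ := by rw [hA, hh, real_inner_comm]
    simp only [sum_k, Finset.sum_add_distrib, Finset.sum_sub_distrib, ← Finset.mul_sum,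
      ← Finset.sum_mul, e.sum_inner_mul_inner_right, hq_ABx, hBx_Aq, hp_BAhx, hAhx_Bp, hp_Bx, hAhx_q]
    ring
  have hhABp_q : ⟪h (A (B p)), q⟫ = ⟪h q, A (B p)⟫ := by rw [hh, real_inner_comm]
  simp only [sum_j, Finset.sum_add_distrib, Finset.sum_sub_distrib, ← Finset.mul_sum,
    ← Finset.sum_mul, e.sum_inner_mul_inner_right, hhABp_q]

theorem inner_skew_of_orthogonal_of_sq_eq_neg {A : V →ₗ[ℝ] V} (hA2 : ∀ x, A (A x) = -x)
    (hA : ∀ x y, ⟪A x, A y⟫ = ⟪x, y⟫) (x y : V) : ⟪A x, y⟫ = -⟪x, A y⟫ := by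
  rw [← hA x (A y), hA2, inner_neg_right, neg_neg]

theorem inner_eq_zero_of_skew_of_anticomm {A B : V →ₗ[ℝ] V}
    (hA : ∀ x y, ⟪A x, y⟫ = -⟪x, A y⟫) (hB : ∀ x y, ⟪B x, y⟫ = -⟪x, B y⟫)
    (hAB : ∀ x, A (B x) = -B (A x)) (x : V) : ⟪A x, B x⟫ = 0 := by
  have h1 : ⟪A x, B x⟫ = -⟪B x, A x⟫ := by
    rw [hA, hAB, inner_neg_right, neg_neg, hB, neg_neg]
  rw [real_inner_comm (A x) (B x)] at h1
  linarith

theorem LinearMap.trace_eq_sum_inner_map (e : OrthonormalBasis ι ℝ V) (h : V →ₗ[ℝ] V) :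
    LinearMap.trace ℝ V h = ∑ i, ⟪h (e i), e i⟫ := by
  classical
  rw [h.trace_eq_sum_inner e]
  exact Finset.sum_congr rfl fun i _ => real_inner_comm _ _

/-- Diagonal contraction: `A` is an orthogonal complex structure and `h` is traceless. -/
theorem sum_wedgeOneTwo_mul_self (e : OrthonormalBasis ι ℝ V) {A h : V →ₗ[ℝ] V}
    (hA2 : ∀ x, A (A x) = -x) (hA : ∀ x y, ⟪A x, A y⟫ = ⟪x, y⟫)
    (hh : ∀ x y, ⟪h x, y⟫ = ⟪x, h y⟫) (htr : LinearMap.trace ℝ V h = 0) (v : V) :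
    ∑ i, ∑ j, ∑ k, wedgeOneTwo (A v) A (h (e i)) (e j) (e k) *
        wedgeOneTwo (A v) A (e i) (e j) (e k) =
      (Fintype.card ι - 4) * ⟪h (A v), A v⟫ - 2 * ⟪h v, v⟫ := by
  have hs := inner_skew_of_orthogonal_of_sq_eq_neg hA2 hA
  rw [sum_wedgeOneTwo_mul_wedgeOneTwo e hs hs hh]
  simp only [hA, hA2, ← LinearMap.trace_eq_sum_inner_map, htr, map_neg, inner_neg_left,
    inner_neg_right, real_inner_self_eq_norm_sq, e.norm_eq_one, Finset.sum_const,
    Finset.card_univ, real_inner_comm v (h v), nsmul_eq_mul, one_pow, mul_one, neg_neg]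
  ring

/-- Off-diagonal contraction, for two anticommuting orthogonal complex structures. -/
theorem sum_wedgeOneTwo_mul_of_anticomm (e : OrthonormalBasis ι ℝ V) {A B h : V →ₗ[ℝ] V}
    (hA2 : ∀ x, A (A x) = -x) (hA : ∀ x y, ⟪A x, A y⟫ = ⟪x, y⟫)
    (hB2 : ∀ x, B (B x) = -x) (hB : ∀ x y, ⟪B x, B y⟫ = ⟪x, y⟫)
    (hAB : ∀ x, A (B x) = -B (A x)) (hh : ∀ x y, ⟪h x, y⟫ = ⟪x, h y⟫) (v : V) :
    ∑ i, ∑ j, ∑ k, wedgeOneTwo (A v) A (h (e i)) (e j) (e k) *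
        wedgeOneTwo (B v) B (e i) (e j) (e k) =
      2 * ⟪h (A v), A v⟫ + 2 * ⟪h (B v), B v⟫ + 2 * ⟪h (A (B v)), A (B v)⟫ := by
  have hsA := inner_skew_of_orthogonal_of_sq_eq_neg hA2 hA
  have hsB := inner_skew_of_orthogonal_of_sq_eq_neg hB2 hB
  have hBA (x : V) : B (A x) = -A (B x) := by rw [hAB, neg_neg]
  rw [sum_wedgeOneTwo_mul_wedgeOneTwo e hsA hsB hh]
  simp only [inner_eq_zero_of_skew_of_anticomm hsA hsB hAB, hBA, hA2, hB2, map_neg,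
    inner_neg_right, Finset.sum_const_zero, neg_neg,
    real_inner_comm (h (A (B v)))]
  ring

end HelperLemmas

/-- Lemma A.1 of the paper (third relation of (5.8)): for a symmetric traceless
endomorphism `h`, `⟨ι_h (v ⌟ Ω), v ⌟ Ω⟩ = -4 ⟨((m+4) C(h) + 3h) v, v⟩` where
`C(h) = Σₐ Iₐ h Iₐ`; the inner product of `3`-forms is `(1/3!) Σ` over an orthonormal
basis. -/
theorem inner_iota_interior_kraines
    {V : Type*} [NormedAddCommGroup V] [InnerProductSpace ℝ V] [FiniteDimensional ℝ V]
    {m : ℕ} (e : OrthonormalBasis (Fin (2 * m)) ℝ V)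
    (I : Fin 3 → V →ₗ[ℝ] V)
    (hI2 : ∀ a, ∀ x : V, I a (I a x) = -x)
    (hIorth : ∀ a, ∀ x y : V, ⟪I a x, I a y⟫ = ⟪x, y⟫)
    (h12 : ∀ x : V, I 0 (I 1 x) = I 2 x)
    (h21 : ∀ x : V, I 1 (I 0 x) = -(I 2 x))
    (h : V →ₗ[ℝ] V) (hsym : ∀ x y : V, ⟪h x, y⟫ = ⟪x, h y⟫)
    (htr : LinearMap.trace ℝ V h = 0) :
    ∀ v : V,
      (1 / 6 : ℝ) * ∑ i, ∑ j, ∑ k,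
          (kraines I v (h (e i)) (e j) (e k) + kraines I v (e i) (h (e j)) (e k) +
            kraines I v (e i) (e j) (h (e k))) * kraines I v (e i) (e j) (e k)
        = -4 * (((m : ℝ) + 4) * (∑ a : Fin 3, ⟪I a (h (I a v)), v⟫) + 3 * ⟪h v, v⟫) := by
  intro v
  have hskew a := inner_skew_of_orthogonal_of_sq_eq_neg (hI2 a) (hIorth a)
  have hswap (x y z : V) : kraines I v y x z = -kraines I v x y z := by
    simp only [kraines_eq_sum_wedgeOneTwo, wedgeOneTwo_swap (hskew _) _ x y z,
      Finset.sum_neg_distrib, mul_neg]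
  have hrot (x y z : V) : kraines I v z x y = kraines I v x y z := by
    simp only [kraines_eq_sum_wedgeOneTwo, wedgeOneTwo_rotate (hskew _) _ x y z]
  have hsecond : ∑ i, ∑ j, ∑ k,
      kraines I v (e i) (h (e j)) (e k) * kraines I v (e i) (e j) (e k) =
      ∑ i, ∑ j, ∑ k, kraines I v (h (e i)) (e j) (e k) * kraines I v (e i) (e j) (e k) := by
    rw [Finset.sum_comm]
    refine Finset.sum_congr rfl fun i _ => Finset.sum_congr rfl fun j _ =>
      Finset.sum_congr rfl fun k _ => ?_
    rw [hswap (h (e i)), hswap (e i), neg_mul_neg]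
  have hthird : ∑ i, ∑ j, ∑ k,
      kraines I v (e i) (e j) (h (e k)) * kraines I v (e i) (e j) (e k) =
      ∑ i, ∑ j, ∑ k, kraines I v (h (e i)) (e j) (e k) * kraines I v (e i) (e j) (e k) := by
    rw [Finset.sum_congr rfl fun i _ => Finset.sum_comm, Finset.sum_comm]
    refine Finset.sum_congr rfl fun i _ => Finset.sum_congr rfl fun j _ =>
      Finset.sum_congr rfl fun k _ => ?_
    rw [← hrot (e j) (e k) (h (e i)), ← hrot (e j) (e k) (e i)]
  have hsum : ∑ i, ∑ j, ∑ k,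
      kraines I v (h (e i)) (e j) (e k) * kraines I v (e i) (e j) (e k) =
      4 * ∑ a, ∑ b, ∑ i, ∑ j, ∑ k, wedgeOneTwo (I a v) (I a) (h (e i)) (e j) (e k) *
        wedgeOneTwo (I b v) (I b) (e i) (e j) (e k) := by
    simp only [kraines_eq_sum_wedgeOneTwo, Fin.sum_univ_three, ← Finset.sum_add_distrib,
      Finset.mul_sum]
    refine Finset.sum_congr rfl fun i _ => Finset.sum_congr rfl fun j _ =>
      Finset.sum_congr rfl fun k _ => ?_
    ring
  have h01 (x : V) : I 0 (I 1 x) = -I 1 (I 0 x) := by rw [h12, h21, neg_neg]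
  have h10 (x : V) : I 1 (I 0 x) = -I 0 (I 1 x) := by rw [h12, h21]
  have m02 (x : V) : I 0 (I 2 x) = -I 1 x := by rw [← h12, hI2]
  have m20 (x : V) : I 2 (I 0 x) = I 1 x := by rw [← h12, h10, map_neg, hI2, neg_neg]
  have m12 (x : V) : I 1 (I 2 x) = I 0 x := by
    rw [← neg_neg (I 2 x), ← h21, map_neg, hI2, neg_neg]
  have m21 (x : V) : I 2 (I 1 x) = -I 0 x := by rw [← h12, hI2, map_neg]
  have h02 (x : V) : I 0 (I 2 x) = -I 2 (I 0 x) := by rw [m02, m20]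
  have h20 (x : V) : I 2 (I 0 x) = -I 0 (I 2 x) := by rw [m02, m20, neg_neg]
  have h12' (x : V) : I 1 (I 2 x) = -I 2 (I 1 x) := by rw [m12, m21, neg_neg]
  have h21' (x : V) : I 2 (I 1 x) = -I 1 (I 2 x) := by rw [m12, m21]
  have hdiag a := sum_wedgeOneTwo_mul_self e (hI2 a) (hIorth a) hsym htr v
  have hoff {a b : Fin 3} (hab : ∀ x, I a (I b x) = -I b (I a x)) :=
    sum_wedgeOneTwo_mul_of_anticomm e (hI2 a) (hIorth a) (hI2 b) (hIorth b) hab hsym v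
  simp only [add_mul, Finset.sum_add_distrib, hsecond, hthird, hsum]
  simp only [Fin.sum_univ_three, hdiag, hoff h01, hoff h10, hoff h02, hoff h20, hoff h12',
    hoff h21', h12, h21, m02, m20, m12, m21, map_neg, inner_neg_left, inner_neg_right, neg_neg,
    hskew _ (h _) v, Fintype.card_fin, Nat.cast_mul, Nat.cast_ofNat]
  ring
end

section
/- Let V be a real inner product space of dimension 2m with orthonormal basis (e_k) and let J be an orthogonal complex structure on V with Kähler form ω(x,y) = ⟨Jx,y⟩. Let h be a symmetric (self-adjoint) endomorphism of V with tr(h) = 0, h∘J = J∘h and tr(h∘J) = 0. Then for every v ∈ V: ⟨ι_h(v⌟(ω∧ω)), v⌟(ω∧ω)⟩ = 4(m−3)·⟨hv, v⟩. -/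
open scoped RealInnerProductSpace

section KaehlerForm

variable {V : Type*} [NormedAddCommGroup V] [InnerProductSpace ℝ V]

/-- An orthogonal complex structure is skew-adjoint. -/
theorem inner_complexStructure_left {J : V →ₗ[ℝ] V} (hJ2 : ∀ x : V, J (J x) = -x)
    (hJorth : ∀ x y : V, ⟪J x, J y⟫ = ⟪x, y⟫) (x y : V) : ⟪J x, y⟫ = -⟪J y, x⟫ := by
  have key := hJorth (J x) y
  rw [hJ2, inner_neg_left, real_inner_comm] at key
  linarith

/-- The interior product of a vector with the square of the Kähler form. -/
theorem wedge2_kaehlerForm_self {J : V →ₗ[ℝ] V} (v x y z : V) :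
    wedge2 (fun p q => ⟪J p, q⟫) (fun p q => ⟪J p, q⟫) v x y z =
      2 * (⟪J v, x⟫ * ⟪J y, z⟫ - ⟪J v, y⟫ * ⟪J x, z⟫ + ⟪J v, z⟫ * ⟪J x, y⟫) := by
  simp only [wedge2]
  ring

/-- Swapping the second and third arguments of the square of the Kähler form. -/
theorem wedge2_kaehlerForm_swap {J : V →ₗ[ℝ] V} (hJ2 : ∀ x : V, J (J x) = -x)
    (hJorth : ∀ x y : V, ⟪J x, J y⟫ = ⟪x, y⟫) (v x y z : V) :
    wedge2 (fun p q => ⟪J p, q⟫) (fun p q => ⟪J p, q⟫) v x y z =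
      -wedge2 (fun p q => ⟪J p, q⟫) (fun p q => ⟪J p, q⟫) v y x z := by
  rw [wedge2_kaehlerForm_self, wedge2_kaehlerForm_self,
    inner_complexStructure_left hJ2 hJorth x y]
  ring

/-- Swapping the second and fourth arguments of the square of the Kähler form. -/
theorem wedge2_kaehlerForm_swap_last {J : V →ₗ[ℝ] V} (hJ2 : ∀ x : V, J (J x) = -x)
    (hJorth : ∀ x y : V, ⟪J x, J y⟫ = ⟪x, y⟫) (v x y z : V) :
    wedge2 (fun p q => ⟪J p, q⟫) (fun p q => ⟪J p, q⟫) v x y z =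
      -wedge2 (fun p q => ⟪J p, q⟫) (fun p q => ⟪J p, q⟫) v z y x := by
  rw [wedge2_kaehlerForm_self, wedge2_kaehlerForm_self,
    inner_complexStructure_left hJ2 hJorth x y, inner_complexStructure_left hJ2 hJorth x z,
    inner_complexStructure_left hJ2 hJorth y z]
  ring

/-- Contraction of two copies of `v ⌟ ω²` over their last two arguments. -/
theorem sum_wedge2_kaehlerForm_mul {ι : Type*} [Fintype ι] (e : OrthonormalBasis ι ℝ V)
    {J : V →ₗ[ℝ] V} (hJ2 : ∀ x : V, J (J x) = -x)
    (hJorth : ∀ x y : V, ⟪J x, J y⟫ = ⟪x, y⟫) (v x y : V) :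
    ∑ j, ∑ k, wedge2 (fun p q => ⟪J p, q⟫) (fun p q => ⟪J p, q⟫) v x (e j) (e k) *
        wedge2 (fun p q => ⟪J p, q⟫) (fun p q => ⟪J p, q⟫) v y (e j) (e k) =
      4 * (((Fintype.card ι : ℝ) - 4) * (⟪J v, x⟫ * ⟪J v, y⟫) + 2 * ⟪v, v⟫ * ⟪x, y⟫ -
        2 * (⟪v, x⟫ * ⟪v, y⟫)) := by
  have parseval (p q : V) : ∑ j, ⟪p, e j⟫ * ⟪q, e j⟫ = ⟪p, q⟫ := by
    rw [← e.sum_inner_mul_inner p q]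
    exact Finset.sum_congr rfl fun j _ => by rw [real_inner_comm q]
  have inner_sum (j : ι) :
      ∑ k, wedge2 (fun p q => ⟪J p, q⟫) (fun p q => ⟪J p, q⟫) v x (e j) (e k) *
        wedge2 (fun p q => ⟪J p, q⟫) (fun p q => ⟪J p, q⟫) v y (e j) (e k) =
      4 * (⟪J v, x⟫ * ⟪J v, y⟫ - ⟪J v, x⟫ * (⟪J v, e j⟫ * ⟪y, e j⟫) +
        ⟪J v, x⟫ * (⟪J y, e j⟫ * ⟪v, e j⟫) - ⟪J v, y⟫ * (⟪J v, e j⟫ * ⟪x, e j⟫) +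
        ⟪x, y⟫ * (⟪J v, e j⟫ * ⟪J v, e j⟫) - ⟪v, x⟫ * (⟪J v, e j⟫ * ⟪J y, e j⟫) +
        ⟪J v, y⟫ * (⟪J x, e j⟫ * ⟪v, e j⟫) - ⟪v, y⟫ * (⟪J x, e j⟫ * ⟪J v, e j⟫) +
        ⟪v, v⟫ * (⟪J x, e j⟫ * ⟪J y, e j⟫)) := by
    have expand (u : V) (k : ι) :
        wedge2 (fun p q => ⟪J p, q⟫) (fun p q => ⟪J p, q⟫) v u (e j) (e k) =
        ⟪J ((2 : ℝ) • (⟪J v, u⟫ • e j - ⟪J v, e j⟫ • u + ⟪J u, e j⟫ • v)), e k⟫ := by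
      simp only [wedge2_kaehlerForm_self, map_add, map_sub, map_smul, inner_add_left,
        inner_sub_left, real_inner_smul_left]
      ring
    simp only [expand, parseval, hJorth]
    simp only [inner_add_left, inner_sub_left, inner_add_right, inner_sub_right,
      real_inner_smul_left, real_inner_smul_right, real_inner_comm _ (e j), real_inner_comm x v,
      e.inner_eq_one]
    ring
  simp only [inner_sum, ← Finset.mul_sum, Finset.sum_add_distrib, Finset.sum_sub_distrib,
    parseval, hJorth, Finset.sum_const, Finset.card_univ, nsmul_eq_mul]
  rw [inner_complexStructure_left hJ2 hJorth x v, inner_complexStructure_left hJ2 hJorth y v,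
    real_inner_comm v x]
  ring

end KaehlerForm

/-- The first relation of (5.8): for a symmetric traceless `J`-commuting endomorphism
`h` with `tr(h∘J) = 0`, `⟨ι_h (v ⌟ ω²), v ⌟ ω²⟩ = 4(m-3) ⟨hv, v⟩`; the inner product of
`3`-forms is `(1/3!) Σ` over an orthonormal basis. -/
theorem inner_iota_interior_omega_sq
    {V : Type*} [NormedAddCommGroup V] [InnerProductSpace ℝ V] [FiniteDimensional ℝ V]
    {m : ℕ} (e : OrthonormalBasis (Fin (2 * m)) ℝ V)
    (J : V →ₗ[ℝ] V) (hJ2 : ∀ x : V, J (J x) = -x)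
    (hJorth : ∀ x y : V, ⟪J x, J y⟫ = ⟪x, y⟫)
    (h : V →ₗ[ℝ] V) (hsym : ∀ x y : V, ⟪h x, y⟫ = ⟪x, h y⟫)
    (htr : LinearMap.trace ℝ V h = 0)
    (hhJ : ∀ x : V, h (J x) = J (h x))
    (htrJ : LinearMap.trace ℝ V (h ∘ₗ J) = 0) :
    ∀ v : V,
      (1 / 6 : ℝ) * ∑ i, ∑ j, ∑ k,
          (wedge2 (fun p q => ⟪J p, q⟫) (fun p q => ⟪J p, q⟫) v (h (e i)) (e j) (e k) +
            wedge2 (fun p q => ⟪J p, q⟫) (fun p q => ⟪J p, q⟫) v (e i) (h (e j)) (e k) +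
            wedge2 (fun p q => ⟪J p, q⟫) (fun p q => ⟪J p, q⟫) v (e i) (e j) (h (e k))) *
            wedge2 (fun p q => ⟪J p, q⟫) (fun p q => ⟪J p, q⟫) v (e i) (e j) (e k)
        = 4 * ((m : ℝ) - 3) * ⟪h v, v⟫ := by
  intro v
  set φ := wedge2 (fun p q => ⟪J p, q⟫) (fun p q => ⟪J p, q⟫) v with hφ
  have swap (x y z : V) : φ x y z = -φ y x z := wedge2_kaehlerForm_swap hJ2 hJorth v x y z
  have swap_last (x y z : V) : φ x y z = -φ z y x :=
    wedge2_kaehlerForm_swap_last hJ2 hJorth v x y z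
  have second : ∑ i, ∑ j, ∑ k, φ (e i) (h (e j)) (e k) * φ (e i) (e j) (e k) =
      ∑ i, ∑ j, ∑ k, φ (h (e i)) (e j) (e k) * φ (e i) (e j) (e k) := by
    rw [Finset.sum_comm]
    refine Finset.sum_congr rfl fun i _ => Finset.sum_congr rfl fun j _ =>
      Finset.sum_congr rfl fun k _ => ?_
    rw [swap (e j) (h (e i)), swap (e j) (e i), neg_mul_neg]
  have third : ∑ i, ∑ j, ∑ k, φ (e i) (e j) (h (e k)) * φ (e i) (e j) (e k) =
      ∑ i, ∑ j, ∑ k, φ (h (e i)) (e j) (e k) * φ (e i) (e j) (e k) := by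
    calc _ = ∑ j, ∑ k, ∑ i, φ (e i) (e j) (h (e k)) * φ (e i) (e j) (e k) := by
          rw [Finset.sum_comm]
          exact Finset.sum_congr rfl fun j _ => Finset.sum_comm
      _ = ∑ k, ∑ j, ∑ i, φ (e i) (e j) (h (e k)) * φ (e i) (e j) (e k) := Finset.sum_comm
      _ = _ := by
          refine Finset.sum_congr rfl fun i _ => Finset.sum_congr rfl fun j _ =>
            Finset.sum_congr rfl fun k _ => ?_
          rw [swap_last (e k) (e j) (h (e i)), swap_last (e k) (e j) (e i), neg_mul_neg]
  have first : ∑ i, ∑ j, ∑ k, φ (h (e i)) (e j) (e k) * φ (e i) (e j) (e k) =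
      8 * ((m : ℝ) - 3) * ⟪h v, v⟫ := by
    have sum_apply (p : V) : ∑ i, ⟪p, h (e i)⟫ * ⟪p, e i⟫ = ⟪h p, p⟫ := by
      rw [← e.sum_inner_mul_inner (h p) p]
      exact Finset.sum_congr rfl fun i _ => by rw [hsym, real_inner_comm p]
    have sum_diag : ∑ i, ⟪h (e i), e i⟫ = 0 := by
      rw [← htr, LinearMap.trace_eq_sum_inner h e]
      exact Finset.sum_congr rfl fun i _ => hsym _ _
    simp only [hφ, sum_wedge2_kaehlerForm_mul e hJ2 hJorth, ← Finset.mul_sum,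
      Finset.sum_add_distrib, Finset.sum_sub_distrib, sum_apply, sum_diag, hhJ, hJorth,
      Fintype.card_fin]
    push_cast
    ring
  simp only [add_mul, Finset.sum_add_distrib, second, third, first]
  ring
end
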